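/- For every unitary matrix Θ ∈ ℂ^{N_S×N_S}, the squared Frobenius norm of the indirect channel satisfies ∑_{n=1}^{N_S} σ_n(H_B)²·σ_{N_S−n+1}(H_F)² ≤ ‖H_B·Θ·H_F‖_F² ≤ ∑_{n=1}^{N_S} σ_n(H_B)²·σ_n(H_F)². -/

import Mathlib

open Matrix

noncomputable def nthLargest {m : ℕ} (f : Fin m → ℝ) (n : ℕ) : ℝ :=
  if h : 1 ≤ n ∧ n ≤ m then (f ∘ Tuple.sort f) ⟨m - n, by omega⟩ else 0

noncomputable def nthEig {m : ℕ} (Y : Matrix (Fin m) (Fin m) ℂ) (hY : Y.IsHermitian) (n : ℕ) : ℝ :=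
  nthLargest hY.eigenvalues n

/-- The `n`-th largest singular value (1-based) of a complex matrix, equal to the square root
of the `n`-th largest eigenvalue of `A * Aᴴ`, with the convention that it is `0` whenever
`n` exceeds the matrix dimensions. -/
noncomputable def singVal {r c : ℕ} (A : Matrix (Fin r) (Fin c) ℂ) (n : ℕ) : ℝ :=
  Real.sqrt (nthLargest (Matrix.isHermitian_mul_conjTranspose_self A).eigenvalues n)


lemma nthLargest_nonneg {m : ℕ} (f : Fin m → ℝ) (hf : ∀ i, 0 ≤ f i) (n : ℕ) :
    0 ≤ nthLargest f n := by
  unfold nthLargest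
  split_ifs
  · exact hf _
  · exact le_rfl

lemma lt_nthLargest_iff {m : ℕ} (f : Fin m → ℝ) (n : ℕ) (hn : 1 ≤ n) (t : ℝ) (ht : 0 ≤ t) :
    t < nthLargest f n ↔ n ≤ (Finset.univ.filter (fun i => t < f i)).card := by
  have hmono := Tuple.monotone_sort f
  have hcard : (Finset.univ.filter (fun i => t < f i)).card =
      (Finset.univ.filter (fun i => t < (f ∘ Tuple.sort f) i)).card := by
    symm
    apply Finset.card_bij (fun i _ => Tuple.sort f i)
    · intro a ha; simpa using ha
    · intro a _ b _ h; exact (Tuple.sort f).injective h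
    · intro b hb
      exact ⟨(Tuple.sort f).symm b, by simpa using hb, by simp⟩
  rw [hcard]
  by_cases h : n ≤ m
  · unfold nthLargest
    rw [dif_pos ⟨hn, h⟩]
    constructor
    · intro hlt
      have hsub : Finset.Ici (⟨m - n, by omega⟩ : Fin m) ⊆
          Finset.univ.filter (fun i => t < (f ∘ Tuple.sort f) i) := by
        intro i hi
        simp only [Finset.mem_Ici] at hi
        simp only [Finset.mem_filter, Finset.mem_univ, true_and]
        exact lt_of_lt_of_le hlt (hmono hi)
      have := Finset.card_le_card hsub
      rw [Fin.card_Ici] at this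
      simp only at this
      omega
    · intro hle
      by_contra hlt
      push Not at hlt
      have hsub : Finset.univ.filter (fun i => t < (f ∘ Tuple.sort f) i) ⊆
          Finset.Ioi (⟨m - n, by omega⟩ : Fin m) := by
        intro i hi
        simp only [Finset.mem_filter, Finset.mem_univ, true_and] at hi
        simp only [Finset.mem_Ioi]
        by_contra hc
        push Not at hc
        exact absurd (lt_of_lt_of_le hi (hmono hc)) (not_lt.mpr hlt)
      have := Finset.card_le_card hsub
      rw [Fin.card_Ioi] at this
      simp only at this
      omega
  · unfold nthLargest
    rw [dif_neg (by omega)]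
    have := Finset.card_le_univ (Finset.univ.filter (fun i => t < (f ∘ Tuple.sort f) i))
    simp only [Fintype.card_fin] at this
    constructor
    · intro h; linarith
    · intro h; omega

lemma nthLargest_congr {m k : ℕ} (f : Fin m → ℝ) (g : Fin k → ℝ) (hf : ∀ i, 0 ≤ f i)
    (hg : ∀ i, 0 ≤ g i)
    (h : ∀ t : ℝ, 0 ≤ t → (Finset.univ.filter (fun i => t < f i)).card =
      (Finset.univ.filter (fun i => t < g i)).card) (n : ℕ) (hn : 1 ≤ n) :
    nthLargest f n = nthLargest g n := by
  rcases lt_trichotomy (nthLargest f n) (nthLargest g n) with hl | hl | hl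
  · have h0 := nthLargest_nonneg f hf n
    have := hl
    rw [lt_nthLargest_iff g n hn _ h0, ← h _ h0, ← lt_nthLargest_iff f n hn _ h0] at this
    exact absurd this (lt_irrefl _)
  · exact hl
  · have h0 := nthLargest_nonneg g hg n
    have := hl
    rw [lt_nthLargest_iff f n hn _ h0, h _ h0, ← lt_nthLargest_iff g n hn _ h0] at this
    exact absurd this (lt_irrefl _)

open scoped ComplexOrder in
lemma eig_nonneg {r c : ℕ} (A : Matrix (Fin r) (Fin c) ℂ) (i : Fin r) :
    0 ≤ (Matrix.isHermitian_mul_conjTranspose_self A).eigenvalues i :=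
  (Matrix.posSemidef_self_mul_conjTranspose A).eigenvalues_nonneg i

open scoped ComplexOrder in
lemma eig_nonneg' {r c : ℕ} (A : Matrix (Fin r) (Fin c) ℂ) (i : Fin c) :
    0 ≤ (Matrix.isHermitian_conjTranspose_mul_self A).eigenvalues i :=
  (Matrix.posSemidef_conjTranspose_mul_self A).eigenvalues_nonneg i

lemma card_eig_eq {m : ℕ} (Y : Matrix (Fin m) (Fin m) ℂ) (hY : Y.IsHermitian) (t : ℝ) :
    (Finset.univ.filter (fun i => t < hY.eigenvalues i)).card =
      Multiset.countP (fun z : ℂ => t < z.re) Y.charpoly.roots := by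
  classical
  rw [hY.roots_charpoly_eq_eigenvalues, Multiset.countP_map]
  simp [Finset.card]

lemma card_eig {r c : ℕ} (A : Matrix (Fin r) (Fin c) ℂ) (t : ℝ) (ht : 0 ≤ t) :
    (Finset.univ.filter
      (fun i => t < (Matrix.isHermitian_mul_conjTranspose_self A).eigenvalues i)).card =
    (Finset.univ.filter
      (fun i => t < (Matrix.isHermitian_conjTranspose_mul_self A).eigenvalues i)).card := by
  classical
  rw [card_eig_eq, card_eig_eq]
  have h := Matrix.charpoly_mul_comm' A Aᴴ
  have h2 := congrArg (fun p => Multiset.countP (fun z : ℂ => t < z.re) p.roots) h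
  rw [Polynomial.roots_mul, Polynomial.roots_mul, Multiset.countP_add, Multiset.countP_add] at h2
  · simpa [Multiset.countP_nsmul, Polynomial.roots_pow, not_lt.mpr ht, 
      ← Multiset.cons_zero, Multiset.countP_cons] using h2
  · exact mul_ne_zero (pow_ne_zero _ Polynomial.X_ne_zero) (Matrix.charpoly_monic _).ne_zero
  · exact mul_ne_zero (pow_ne_zero _ Polynomial.X_ne_zero) (Matrix.charpoly_monic _).ne_zero

lemma singVal_sq {r c : ℕ} (A : Matrix (Fin r) (Fin c) ℂ) (n : ℕ) :
    singVal A n ^ 2 = nthLargest (Matrix.isHermitian_mul_conjTranspose_self A).eigenvalues n :=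
  Real.sq_sqrt (nthLargest_nonneg _ (eig_nonneg A) n)

lemma singVal_sq' {r c : ℕ} (A : Matrix (Fin r) (Fin c) ℂ) (n : ℕ) (hn : 1 ≤ n) :
    singVal A n ^ 2 = nthLargest (Matrix.isHermitian_conjTranspose_mul_self A).eigenvalues n := by
  rw [singVal_sq]
  exact nthLargest_congr _ _ (eig_nonneg A) (eig_nonneg' A) (card_eig A) n hn

lemma nthLargest_sub {m : ℕ} (f : Fin m → ℝ) (i : Fin m) :
    nthLargest f (m - i) = (f ∘ Tuple.sort f) i := by
  unfold nthLargest
  have := i.2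
  rw [dif_pos (by omega)]
  congr 1
  ext
  simp only
  omega

lemma sum_Icc_eq {m : ℕ} (F : ℕ → ℝ) :
    ∑ n ∈ Finset.Icc 1 m, F n = ∑ i : Fin m, F (m - i) := by
  symm
  apply Finset.sum_bij (fun (i : Fin m) _ => m - (i : ℕ))
  · intro i _; have := i.2; simp only [Finset.mem_Icc]; omega
  · intro a _ b _ h; have := a.2; have := b.2; ext; omega
  · intro b hb
    simp only [Finset.mem_Icc] at hb
    exact ⟨⟨m - b, by omega⟩, Finset.mem_univ _, by simp only; omega⟩
  · intro i _; rfl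

lemma perm_bounds {m : ℕ} (p q : Fin m → ℝ) (σ : Equiv.Perm (Fin m)) :
    ∑ i, (p ∘ Tuple.sort p) i * (q ∘ Tuple.sort q) (Fin.rev i) ≤ ∑ i, p i * q (σ i) ∧
    ∑ i, p i * q (σ i) ≤ ∑ i, (p ∘ Tuple.sort p) i * (q ∘ Tuple.sort q) i := by
  have hp := Tuple.monotone_sort p
  have hq := Tuple.monotone_sort q
  have e : ∑ i, p i * q (σ i) = ∑ i, (p ∘ Tuple.sort p) i *
      (q ∘ Tuple.sort q) (((Tuple.sort p).trans (σ.trans (Tuple.sort q).symm)) i) := by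
    rw [← Equiv.sum_comp (Tuple.sort p)]
    simp
  constructor
  · rw [e]
    have ha : Antivary (p ∘ Tuple.sort p) ((q ∘ Tuple.sort q) ∘ Fin.rev) :=
      hp.antivary (hq.comp_antitone Fin.rev_anti)
    have := ha.sum_mul_le_sum_mul_comp_perm
      (σ := ((Tuple.sort p).trans (σ.trans (Tuple.sort q).symm)).trans Fin.revPerm)
    simpa using this
  · rw [e]
    exact (hp.monovary hq).sum_mul_comp_perm_le_sum_mul

lemma ds_bounds {m : ℕ} (p q : Fin m → ℝ) (D : Matrix (Fin m) (Fin m) ℝ)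
    (hD : D ∈ doublyStochastic ℝ (Fin m)) :
    ∑ i, (p ∘ Tuple.sort p) i * (q ∘ Tuple.sort q) (Fin.rev i) ≤ ∑ i, ∑ j, p i * q j * D i j ∧
    ∑ i, ∑ j, p i * q j * D i j ≤ ∑ i, (p ∘ Tuple.sort p) i * (q ∘ Tuple.sort q) i := by
  obtain ⟨w, hw0, hw1, hw⟩ := exists_eq_sum_perm_of_mem_doublyStochastic hD
  have e : ∑ i, ∑ j, p i * q j * D i j = ∑ σ, w σ * ∑ i, p i * q (σ i) := by
    rw [← hw]
    simp only [Matrix.sum_apply, Matrix.smul_apply, Equiv.Perm.permMatrix, PEquiv.toMatrix_apply,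
      smul_eq_mul, Finset.mul_sum]
    simp_rw [Finset.sum_comm (s := Finset.univ (α := Fin m)) (t := Finset.univ (α := Equiv.Perm (Fin m)))]
    refine Finset.sum_congr rfl fun σ _ => Finset.sum_congr rfl fun i _ => ?_
    simp [mul_comm]
  rw [e]
  have key : ∀ c : ℝ, c = ∑ σ, w σ * c := fun c => by rw [← Finset.sum_mul, hw1, one_mul]
  constructor
  · rw [key (∑ i, _)]
    exact Finset.sum_le_sum fun σ _ =>
      mul_le_mul_of_nonneg_left (perm_bounds p q σ).1 (hw0 σ)
  · rw [key (∑ i, (p ∘ Tuple.sort p) i * (q ∘ Tuple.sort q) i)]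
    exact Finset.sum_le_sum fun σ _ =>
      mul_le_mul_of_nonneg_left (perm_bounds p q σ).2 (hw0 σ)

lemma unitary_ds {m : ℕ} (W : Matrix (Fin m) (Fin m) ℂ) (h : Wᴴ * W = 1) :
    (Matrix.of fun i j => Complex.normSq (W i j)) ∈ doublyStochastic ℝ (Fin m) := by
  have h' : W * Wᴴ = 1 := mul_eq_one_comm.mp h
  rw [mem_doublyStochastic_iff_sum]
  refine ⟨fun i j => Complex.normSq_nonneg _, fun i => ?_, fun j => ?_⟩
  · have := congrFun (congrFun h' i) i
    simp only [Matrix.mul_apply, Matrix.conjTranspose_apply, Matrix.one_apply_eq] at this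
    apply Complex.ofReal_injective
    rw [Complex.ofReal_one, ← this, Complex.ofReal_sum]
    refine Finset.sum_congr rfl fun j _ => ?_
    simp [← Complex.mul_conj]
  · have := congrFun (congrFun h j) j
    simp only [Matrix.mul_apply, Matrix.conjTranspose_apply, Matrix.one_apply_eq] at this
    apply Complex.ofReal_injective
    rw [Complex.ofReal_one, ← this, Complex.ofReal_sum]
    refine Finset.sum_congr rfl fun i _ => ?_
    simp [Complex.normSq_eq_conj_mul_self]

lemma trace_diag {m : ℕ} (p q : Fin m → ℝ) (W : Matrix (Fin m) (Fin m) ℂ) :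
    (Matrix.trace (Matrix.diagonal (fun i => (p i : ℂ)) * W * Matrix.diagonal (fun i => (q i : ℂ))
      * Wᴴ)).re = ∑ i, ∑ j, p i * q j * Complex.normSq (W i j) := by
  have : Matrix.trace (Matrix.diagonal (fun i => (p i : ℂ)) * W *
      Matrix.diagonal (fun i => (q i : ℂ)) * Wᴴ) =
      ((∑ i, ∑ j, p i * q j * Complex.normSq (W i j) : ℝ) : ℂ) := by
    simp only [Matrix.trace, Matrix.diag_apply, Matrix.mul_apply (N := Wᴴ), Matrix.mul_diagonal,
      Matrix.diagonal_mul, Matrix.conjTranspose_apply]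
    push_cast
    refine Finset.sum_congr rfl fun i _ => Finset.sum_congr rfl fun j _ => ?_
    rw [← Complex.mul_conj]
    simp only [RCLike.star_def]
    ring
  rw [this, Complex.ofReal_re]

lemma trace_bounds {m : ℕ} (P Q Θ : Matrix (Fin m) (Fin m) ℂ) (hP : P.IsHermitian)
    (hQ : Q.IsHermitian) (hΘ : Θᴴ * Θ = 1) :
    ∃ D ∈ doublyStochastic ℝ (Fin m), (Matrix.trace (P * Θ * Q * Θᴴ)).re =
      ∑ i, ∑ j, hP.eigenvalues i * hQ.eigenvalues j * D i j := by
  have eP := hP.spectral_theorem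
  have eQ := hQ.spectral_theorem
  rw [Unitary.conjStarAlgAut_apply] at eP eQ
  have hU := Unitary.star_mul_self_of_mem hP.eigenvectorUnitary.2
  have hV := Unitary.star_mul_self_of_mem hQ.eigenvectorUnitary.2
  have hU' := Unitary.mul_star_self_of_mem hP.eigenvectorUnitary.2
  set U : Matrix (Fin m) (Fin m) ℂ := hP.eigenvectorUnitary.1
  set V : Matrix (Fin m) (Fin m) ℂ := hQ.eigenvectorUnitary.1
  simp only [Matrix.star_eq_conjTranspose] at *
  refine ⟨_, unitary_ds (Uᴴ * Θ * V) ?_, ?_⟩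
  · simp only [Matrix.conjTranspose_mul, Matrix.conjTranspose_conjTranspose]
    calc Vᴴ * (Θᴴ * U) * (Uᴴ * Θ * V) = Vᴴ * (Θᴴ * (U * Uᴴ) * Θ) * V := by
          simp only [Matrix.mul_assoc]
      _ = 1 := by rw [hU', Matrix.mul_one, hΘ, Matrix.mul_one, hV]
  · simp only [Matrix.of_apply]
    rw [← trace_diag]
    congr 1
    conv_lhs => rw [eP, eQ]
    simp only [Matrix.conjTranspose_mul, Matrix.conjTranspose_conjTranspose]
    simp only [Matrix.mul_assoc]
    rw [Matrix.trace_mul_comm]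
    simp only [Matrix.mul_assoc]
    rfl

theorem stmt14 {N_R N_S N_T : ℕ}
    (H_B : Matrix (Fin N_R) (Fin N_S) ℂ) (H_F : Matrix (Fin N_S) (Fin N_T) ℂ)
    (Θ : Matrix (Fin N_S) (Fin N_S) ℂ) (hΘ : Θᴴ * Θ = 1) :
    ∑ n ∈ Finset.Icc 1 N_S, (singVal H_B n) ^ 2 * (singVal H_F (N_S - n + 1)) ^ 2 ≤
      (Matrix.trace ((H_B * Θ * H_F) * (H_B * Θ * H_F)ᴴ)).re ∧
    (Matrix.trace ((H_B * Θ * H_F) * (H_B * Θ * H_F)ᴴ)).re ≤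
      ∑ n ∈ Finset.Icc 1 N_S, (singVal H_B n) ^ 2 * (singVal H_F n) ^ 2 := by
  obtain ⟨D, hD, hT⟩ := trace_bounds _ _ Θ (Matrix.isHermitian_conjTranspose_mul_self H_B)
    (Matrix.isHermitian_mul_conjTranspose_self H_F) hΘ
  have e : Matrix.trace ((H_B * Θ * H_F) * (H_B * Θ * H_F)ᴴ) =
      Matrix.trace (H_Bᴴ * H_B * Θ * (H_F * H_Fᴴ) * Θᴴ) := by
    simp only [Matrix.conjTranspose_mul, ← Matrix.mul_assoc]
    rw [Matrix.trace_mul_comm]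
    simp only [Matrix.mul_assoc]
  rw [e, hT, sum_Icc_eq, sum_Icc_eq]
  have hb := ds_bounds (Matrix.isHermitian_conjTranspose_mul_self H_B).eigenvalues
    (Matrix.isHermitian_mul_conjTranspose_self H_F).eigenvalues D hD
  refine ⟨le_trans (le_of_eq ?_) hb.1, le_trans hb.2 (le_of_eq ?_)⟩
  · refine Finset.sum_congr rfl fun i _ => ?_
    have hi := i.2
    rw [singVal_sq' H_B _ (by omega), singVal_sq, nthLargest_sub, ← nthLargest_sub _ (Fin.rev i)]
    congr 2
    simp only [Fin.val_rev]
    omega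
  · refine Finset.sum_congr rfl fun i _ => ?_
    have hi := i.2
    rw [singVal_sq' H_B _ (by omega), singVal_sq, nthLargest_sub, nthLargest_sub]
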